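/- arXiv:1912.06560 — 9 statements merged into one kernel-verified Lean document; each statement's English description precedes it below -/
import Mathlib

section
/- Let X = (X_1,...,X_m) be a random vector in R^m on a probability space, let v be a real number such that P(X_i > v) > 0 for every i in M = {1,...,m}, and let g : R^m -> R be a bounded measurable function. For x in R^m let N(x) = #{i in M : x_i > v}, and set pi_j = P(X_j > v) / (sum over i in M of P(X_i > v)). Then E[ g(X) | max_{i in M} X_i > v ] = ( (sum over i in M of P(X_i > v)) / P(max_{i in M} X_i > v) ) * ( sum over j in M of pi_j * E[ g(X)/N(X) | X_j > v ] ). -/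
open MeasureTheory ProbabilityTheory Filter Topology

/-- Importance sampling identity (first equality of Proposition 2):
`E[g(X) | max_i X_i > v]` equals `(∑_i P(X_i > v) / P(max_i X_i > v))` times
`∑_j π_j E[g(X)/N(X) | X_j > v]`, where `N(x)` counts coordinates exceeding `v`
and `π_j = P(X_j > v) / ∑_i P(X_i > v)`. -/
theorem conditional_expectation_importance_sampling_first
    {Ω : Type*} [MeasurableSpace Ω] (μ : Measure Ω) [IsProbabilityMeasure μ]
    {m : ℕ} (hm : 0 < m)
    (X : Ω → Fin m → ℝ) (hX : Measurable X)
    (v : ℝ) (hv : ∀ i, 0 < μ {ω | v < X ω i})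
    (g : (Fin m → ℝ) → ℝ) (hg : Measurable g) (C : ℝ) (hgb : ∀ x, |g x| ≤ C) :
    (∫ ω in {ω | ∃ i, v < X ω i}, g (X ω) ∂μ) / (μ {ω | ∃ i, v < X ω i}).toReal
      = ((∑ i, (μ {ω | v < X ω i}).toReal) / (μ {ω | ∃ i, v < X ω i}).toReal) *
        ∑ j, ((μ {ω | v < X ω j}).toReal / ∑ i, (μ {ω | v < X ω i}).toReal) *
          ((∫ ω in {ω | v < X ω j},
              g (X ω) / ((Finset.univ.filter fun i => v < X ω i).card : ℝ) ∂μ) /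
            (μ {ω | v < X ω j}).toReal) := by
  have hmeas : ∀ j, MeasurableSet {ω | v < X ω j} := fun j =>
    measurableSet_lt measurable_const ((measurable_pi_apply j).comp hX)
  have hA : MeasurableSet {ω | ∃ i, v < X ω i} := by
    rw [Set.setOf_exists]
    exact MeasurableSet.iUnion hmeas
  have hN : Measurable fun ω => ((Finset.univ.filter fun i => v < X ω i).card : ℝ) := by
    have h : (fun ω => ((Finset.univ.filter fun i => v < X ω i).card : ℝ))
        = fun ω => ∑ i, if v < X ω i then (1 : ℝ) else 0 := by
      funext ω
      simp
    rw [h]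
    exact Finset.measurable_sum _ fun i _ =>
      Measurable.ite (hmeas i) measurable_const measurable_const
  have hint : Integrable
      (fun ω => g (X ω) / ((Finset.univ.filter fun i => v < X ω i).card : ℝ)) μ := by
    refine Integrable.of_bound ((hg.comp hX).div hN).aestronglyMeasurable C ?_
    refine Filter.Eventually.of_forall fun ω => ?_
    rw [Real.norm_eq_abs, abs_div, Nat.abs_cast]
    rcases Nat.eq_zero_or_pos (Finset.univ.filter fun i => v < X ω i).card with h | h
    · rw [h]
      simpa using (abs_nonneg _).trans (hgb (X ω))
    · exact (div_le_self (abs_nonneg _) (by exact_mod_cast h)).trans (hgb _)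
  have key : ∫ ω in {ω | ∃ i, v < X ω i}, g (X ω) ∂μ
      = ∑ j, ∫ ω in {ω | v < X ω j},
          g (X ω) / ((Finset.univ.filter fun i => v < X ω i).card : ℝ) ∂μ := by
    rw [← integral_indicator hA]
    simp_rw [← integral_indicator (hmeas _)]
    rw [← integral_finsetSum _ fun j _ => hint.indicator (hmeas j)]
    congr 1
    funext ω
    simp only [Set.indicator_apply, Set.mem_setOf_eq]
    rw [← Finset.sum_filter, Finset.sum_const, nsmul_eq_mul]
    split_ifs with h
    · have h0 : ((Finset.univ.filter fun i => v < X ω i).card : ℝ) ≠ 0 := by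
        obtain ⟨i, hi⟩ := h
        exact_mod_cast (Finset.card_pos.2 ⟨i, by simpa using hi⟩).ne'
      rw [mul_div_cancel₀ _ h0]
    · have h0 : (Finset.univ.filter fun i => v < X ω i) = ∅ := by
        push Not at h
        simpa [Finset.filter_eq_empty_iff] using h
      simp [h0]
  have hp : ∀ j, 0 < (μ {ω | v < X ω j}).toReal := fun j =>
    ENNReal.toReal_pos (hv j).ne' (measure_ne_top _ _)
  have hS : 0 < ∑ i, (μ {ω | v < X ω i}).toReal :=
    Finset.sum_pos (fun i _ => hp i) ⟨⟨0, hm⟩, Finset.mem_univ _⟩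
  rw [key, Finset.mul_sum, Finset.sum_div]
  refine Finset.sum_congr rfl fun j _ => ?_
  have h1 := (hp j).ne'
  have h2 := hS.ne'
  generalize (∑ i, (μ {ω | v < X ω i}).toReal) = S at *
  generalize (μ {ω | v < X ω j}).toReal = p at *
  field_simp
end

section
/- Let X = (X_1,...,X_m) be a random vector in R^m on a probability space, let v be a real number such that P(X_i > v) > 0 for every i in M = {1,...,m}, and let g : R^m -> R be a bounded measurable function. For x in R^m let N(x) = #{i in M : x_i > v}, and set pi_j = P(X_j > v) / (sum over i in M of P(X_i > v)). Then E[ g(X) | max_{i in M} X_i > v ] = ( sum over j in M of pi_j * E[ g(X)/N(X) | X_j > v ] ) / ( sum over j in M of pi_j * E[ 1/N(X) | X_j > v ] ). -/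
open MeasureTheory ProbabilityTheory Filter Topology

theorem aux_sum_integral
    {Ω : Type*} [MeasurableSpace Ω] (μ : Measure Ω) [IsProbabilityMeasure μ]
    {m : ℕ} (X : Ω → Fin m → ℝ) (hX : Measurable X) (v : ℝ)
    (f : Ω → ℝ) (hf : Measurable f) (C : ℝ) (hfb : ∀ x, |f x| ≤ C) :
    ∑ j, ∫ ω in {ω | v < X ω j},
        f ω / ((Finset.univ.filter fun i => v < X ω i).card : ℝ) ∂μ
      = ∫ ω in {ω | ∃ i, v < X ω i}, f ω ∂μ := by
  have hXi : ∀ i, Measurable fun ω => X ω i := fun i => (measurable_pi_apply i).comp hX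
  have hA : ∀ i, MeasurableSet {ω | v < X ω i} := fun i =>
    measurableSet_lt measurable_const (hXi i)
  have hU : MeasurableSet {ω | ∃ i, v < X ω i} := by
    have : {ω | ∃ i, v < X ω i} = ⋃ i, {ω | v < X ω i} := by ext; simp
    rw [this]
    exact MeasurableSet.iUnion hA
  have hN : Measurable fun ω => ((Finset.univ.filter fun i => v < X ω i).card : ℝ) := by
    simp only [Finset.card_filter, Nat.cast_sum]
    refine Finset.measurable_sum _ fun i _ => ?_
    simp only [Nat.cast_ite]
    exact Measurable.ite (hA i) measurable_const measurable_const
  have hint : Integrable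
      (fun ω => f ω / ((Finset.univ.filter fun i => v < X ω i).card : ℝ)) μ := by
    refine Integrable.of_bound (hf.div hN).aestronglyMeasurable C
      (Filter.Eventually.of_forall fun ω => ?_)
    rw [Real.norm_eq_abs, abs_div, Nat.abs_cast]
    refine le_trans ?_ (hfb ω)
    rcases Nat.eq_zero_or_pos (Finset.univ.filter fun i => v < X ω i).card with h | h
    · rw [h]; simp
    · exact div_le_self (abs_nonneg _) (by exact_mod_cast h)
  simp_rw [← integral_indicator (hA _)]
  rw [← integral_indicator hU, ← integral_finsetSum _ fun j _ => hint.indicator (hA j)]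
  congr 1
  ext ω
  simp only [Set.indicator_apply, Set.mem_setOf_eq]
  rw [← Finset.sum_filter, Finset.sum_const, nsmul_eq_mul]
  split_ifs with h
  · obtain ⟨i, hi⟩ := h
    have : ((Finset.univ.filter fun i => v < X ω i).card : ℝ) ≠ 0 := by
      have : 0 < (Finset.univ.filter fun i => v < X ω i).card :=
        Finset.card_pos.mpr ⟨i, by simpa using hi⟩
      positivity
    field_simp
  · have : (Finset.univ.filter fun i => v < X ω i) = ∅ := by
      push Not at h
      ext i; simpa using h i
    simp [this]

/-- Importance sampling identity (second equality of Proposition 2):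
`E[g(X) | max_i X_i > v]` equals the ratio
`(∑_j π_j E[g(X)/N(X) | X_j > v]) / (∑_j π_j E[1/N(X) | X_j > v])`,
where `N(x)` counts coordinates exceeding `v` and
`π_j = P(X_j > v) / ∑_i P(X_i > v)`. -/
theorem conditional_expectation_importance_sampling_second
    {Ω : Type*} [MeasurableSpace Ω] (μ : Measure Ω) [IsProbabilityMeasure μ]
    {m : ℕ} (hm : 0 < m)
    (X : Ω → Fin m → ℝ) (hX : Measurable X)
    (v : ℝ) (hv : ∀ i, 0 < μ {ω | v < X ω i})
    (g : (Fin m → ℝ) → ℝ) (hg : Measurable g) (C : ℝ) (hgb : ∀ x, |g x| ≤ C) :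
    (∫ ω in {ω | ∃ i, v < X ω i}, g (X ω) ∂μ) / (μ {ω | ∃ i, v < X ω i}).toReal
      = (∑ j, ((μ {ω | v < X ω j}).toReal / ∑ i, (μ {ω | v < X ω i}).toReal) *
          ((∫ ω in {ω | v < X ω j},
              g (X ω) / ((Finset.univ.filter fun i => v < X ω i).card : ℝ) ∂μ) /
            (μ {ω | v < X ω j}).toReal)) /
        (∑ j, ((μ {ω | v < X ω j}).toReal / ∑ i, (μ {ω | v < X ω i}).toReal) *
          ((∫ ω in {ω | v < X ω j},
              1 / ((Finset.univ.filter fun i => v < X ω i).card : ℝ) ∂μ) /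
            (μ {ω | v < X ω j}).toReal)) := by
  have hp : ∀ j, 0 < (μ {ω | v < X ω j}).toReal := fun j =>
    ENNReal.toReal_pos (hv j).ne' (measure_ne_top _ _)
  have hS : 0 < ∑ i, (μ {ω | v < X ω i}).toReal :=
    Finset.sum_pos (fun i _ => hp i) ⟨⟨0, hm⟩, Finset.mem_univ _⟩
  have key : ∀ F : Fin m → ℝ,
      ∑ j, ((μ {ω | v < X ω j}).toReal / ∑ i, (μ {ω | v < X ω i}).toReal) *
        (F j / (μ {ω | v < X ω j}).toReal)
      = (∑ j, F j) / ∑ i, (μ {ω | v < X ω i}).toReal := by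
    intro F
    rw [Finset.sum_div]
    refine Finset.sum_congr rfl fun j _ => ?_
    have := (hp j).ne'
    field_simp
  rw [key, key, aux_sum_integral μ X hX v (fun ω => g (X ω)) (hg.comp hX) C (fun ω => hgb _),
    aux_sum_integral μ X hX v (fun _ => 1) measurable_const 1 (fun _ => by simp),
    div_div_div_cancel_right₀ hS.ne']
  simp [Measure.real]
end

section
/- Let X_1, X_2 be real random variables on a common probability space with identical marginal distributions whose upper endpoint is infinite (so P(X_2 > t) > 0 for all real t), and suppose lim_{x -> infinity} P(X_1 > x | X_2 > x) = 0. Let a, b : R -> R be functions with b(t) > 0 for all sufficiently large t, and suppose that for each real z the limit Gbar(z) := lim_{t -> infinity} P( (X_1 - a(X_2))/b(X_2) > z | X_2 > t ) exists. Assume there exists t_0 such that a(t) > 0 and a is monotonically non-decreasing on (t_0, infinity). If Gbar(z) lies strictly between 0 and 1 for some z in (0, infinity), then a(t) < t for all sufficiently large t. -/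
open MeasureTheory ProbabilityTheory Filter Topology

/-- Proposition (i) on the normalization functions: under asymptotic independence and
convergence of the conditional exceedance probability of the normalized variable,
if the limit `Gbar z ∈ (0,1)` for some `z > 0` and `a` is eventually positive and
non-decreasing, then `a t < t` for all sufficiently large `t`. -/
theorem norming_function_a_lt_id
    {Ω : Type*} [MeasurableSpace Ω] (μ : Measure Ω) [IsProbabilityMeasure μ]
    (X₁ X₂ : Ω → ℝ) (hX₁ : Measurable X₁) (hX₂ : Measurable X₂)
    (hident : Measure.map X₁ μ = Measure.map X₂ μ)
    (hpos : ∀ t : ℝ, 0 < μ {ω | t < X₂ ω})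
    (hAI : Tendsto (fun x => (μ {ω | x < X₁ ω ∧ x < X₂ ω}).toReal /
        (μ {ω | x < X₂ ω}).toReal) atTop (𝓝 0))
    (a b : ℝ → ℝ) (hb : ∀ᶠ t in atTop, 0 < b t)
    (Gbar : ℝ → ℝ)
    (hconv : ∀ z : ℝ, Tendsto (fun t =>
        (μ {ω | z < (X₁ ω - a (X₂ ω)) / b (X₂ ω) ∧ t < X₂ ω}).toReal /
          (μ {ω | t < X₂ ω}).toReal) atTop (𝓝 (Gbar z)))
    (t₀ : ℝ) (ha_pos : ∀ t, t₀ < t → 0 < a t)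
    (ha_mono : ∀ s t, t₀ < s → s ≤ t → a s ≤ a t)
    (z : ℝ) (hz : 0 < z) (hG₀ : 0 < Gbar z) (hG₁ : Gbar z < 1) :
    ∀ᶠ t in atTop, a t < t := by
  obtain ⟨T, hT⟩ := eventually_atTop.1 hb
  have h1 := hAI.eventually (gt_mem_nhds (half_pos hG₀))
  have h2 := (hconv z).eventually (lt_mem_nhds (half_lt_self hG₀))
  filter_upwards [h1, h2, eventually_ge_atTop T, eventually_gt_atTop t₀] with t h1 h2 hTt ht
  by_contra hlt
  have hat : t ≤ a t := not_lt.1 hlt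
  have hsub : {ω | z < (X₁ ω - a (X₂ ω)) / b (X₂ ω) ∧ t < X₂ ω} ⊆
      {ω | t < X₁ ω ∧ t < X₂ ω} := by
    rintro ω ⟨hω, hω2⟩
    refine ⟨?_, hω2⟩
    have hbp := hT (X₂ ω) (hTt.trans hω2.le)
    have hm := ha_mono t (X₂ ω) ht hω2.le
    rw [lt_div_iff₀ hbp] at hω
    have := mul_pos hz hbp
    linarith
  have hle := ENNReal.toReal_mono (measure_ne_top μ _) (measure_mono (μ := μ) hsub)
  have := div_le_div_of_nonneg_right hle
    (ENNReal.toReal_nonneg (a := μ {ω | t < X₂ ω}))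
  linarith
end

section
/- Let Phi denote the cumulative distribution function of the standard normal distribution on R, and define T(y) = -log(1 - Phi(y)). The function T is a strictly increasing bijection from R onto (0, infinity); denote its inverse by T^{-1}. Then T^{-1}(x) = sqrt(2x) + O(log x / sqrt(x)) as x -> infinity; that is, there exist constants C > 0 and x_0 > 1 such that |T^{-1}(x) - sqrt(2x)| <= C * log x / sqrt(x) for all x >= x_0. -/
open MeasureTheory Filter Topology

/-- The standard normal cumulative distribution function. -/
noncomputable def stdNormalCDF (y : ℝ) : ℝ :=
  ∫ t in Set.Iic y, (Real.sqrt (2 * Real.pi))⁻¹ * Real.exp (-t ^ 2 / 2)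

/-- The transformation to standard exponential margins. -/
noncomputable def expTransform (y : ℝ) : ℝ := -Real.log (1 - stdNormalCDF y)

noncomputable def gd (t : ℝ) : ℝ := (Real.sqrt (2 * Real.pi))⁻¹ * Real.exp (-t ^ 2 / 2)

lemma c_pos : 0 < (Real.sqrt (2 * Real.pi))⁻¹ := by positivity

lemma gd_pos (t : ℝ) : 0 < gd t := by unfold gd; positivity

lemma gd_int : Integrable gd := by
  have h := (integrable_exp_neg_mul_sq (b := 1/2) (by norm_num)).const_mul
    (Real.sqrt (2 * Real.pi))⁻¹
  refine h.congr (Eventually.of_forall fun t => ?_)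
  simp only [gd]
  congr 2; ring

lemma gd_total : ∫ t, gd t = 1 := by
  have h : ∫ t, gd t = ∫ t : ℝ, (Real.sqrt (2 * Real.pi))⁻¹ * Real.exp (-(1/2) * t ^ 2) := by
    congr 1; ext t; simp only [gd]; congr 2; ring
  rw [h, integral_const_mul, integral_gaussian]
  have : Real.pi / (1/2) = 2 * Real.pi := by ring
  rw [this]
  exact inv_mul_cancel₀ (by positivity)

noncomputable def qt (y : ℝ) : ℝ := ∫ t in Set.Ioi y, gd t

lemma cdf_add (y : ℝ) : stdNormalCDF y + qt y = 1 := by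
  have := intervalIntegral.integral_Iic_add_Ioi (b := y) gd_int.integrableOn gd_int.integrableOn
  rw [gd_total] at this
  exact this

lemma pos_of_set {s : Set ℝ} (h : 0 < volume s) : 0 < ∫ t in s, gd t := by
  rw [setIntegral_pos_iff_support_of_nonneg_ae
    (Eventually.of_forall fun t => (gd_pos t).le) gd_int.integrableOn]
  have : Function.support gd = Set.univ := by
    ext t; simp [(gd_pos t).ne']
  simpa [this] using h

lemma qt_pos (y : ℝ) : 0 < qt y := pos_of_set (by simp)

lemma qt_lt_one (y : ℝ) : qt y < 1 := by
  have h := cdf_add y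
  have : 0 < stdNormalCDF y := pos_of_set (s := Set.Iic y) (by simp)
  linarith

lemma T_eq (y : ℝ) : expTransform y = -Real.log (qt y) := by
  unfold expTransform
  rw [← cdf_add y]; ring_nf

lemma qt_split {a b : ℝ} (h : a ≤ b) : qt a = (∫ t in Set.Ioc a b, gd t) + qt b := by
  unfold qt
  rw [← Set.Ioc_union_Ioi_eq_Ioi h]
  exact setIntegral_union (Set.Ioc_disjoint_Ioi le_rfl) measurableSet_Ioi
    gd_int.integrableOn gd_int.integrableOn

lemma T_mono : StrictMono expTransform := by
  intro a b h
  rw [T_eq, T_eq]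
  have h1 := qt_split h.le
  have h2 : 0 < ∫ t in Set.Ioc a b, gd t := pos_of_set (by simp [h])
  have := Real.log_lt_log (qt_pos b) (show qt b < qt a by linarith)
  linarith

lemma c_le : (Real.sqrt (2 * Real.pi))⁻¹ ≤ 1 := by
  apply inv_le_one_of_one_le₀
  rw [Real.one_le_sqrt]
  linarith [Real.pi_gt_three]

lemma c_ge : Real.exp (-1) ≤ (Real.sqrt (2 * Real.pi))⁻¹ := by
  rw [Real.exp_neg]
  apply inv_anti₀ (by positivity)
  rw [Real.sqrt_le_left (by positivity)]
  nlinarith [Real.pi_lt_d2, Real.exp_one_gt_d9]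

lemma qt_upper {y : ℝ} (hy : 1 ≤ y) : qt y ≤ Real.exp (-y ^ 2 / 2) := by
  have hd : ∀ x ∈ Set.Ici y, HasDerivAt (fun t : ℝ => -Real.exp (-t ^ 2 / 2))
      (x * Real.exp (-x ^ 2 / 2)) x := by
    intro x _
    have h1 : HasDerivAt (fun t : ℝ => -t ^ 2 / 2) (-x) x := by
      have h := ((hasDerivAt_pow 2 x).neg).div_const 2
      have e : -(((2 : ℕ) : ℝ) * x ^ (2 - 1)) / 2 = -x := by norm_num; ring
      exact HasDerivAt.congr_deriv h e
    have e2 : -(Real.exp (-x ^ 2 / 2) * -x) = x * Real.exp (-x ^ 2 / 2) := by ring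
    exact HasDerivAt.congr_deriv h1.exp.neg e2
  have hl : Tendsto (fun t : ℝ => -Real.exp (-t ^ 2 / 2)) atTop (𝓝 0) := by
    have h2 : Tendsto (fun t : ℝ => t ^ 2 / 2) atTop atTop :=
      (tendsto_pow_atTop two_ne_zero).atTop_div_const (by norm_num)
    have := (Real.tendsto_exp_neg_atTop_nhds_zero.comp h2).neg
    simp only [neg_zero] at this
    refine this.congr fun t => ?_
    simp [neg_div]
  have hpos : ∀ x ∈ Set.Ioi y, 0 ≤ x * Real.exp (-x ^ 2 / 2) := by
    intro x hx
    have : y < x := hx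
    have : 0 ≤ x := by linarith
    positivity
  have hI := integrableOn_Ioi_deriv_of_nonneg' hd hpos hl
  have hE := integral_Ioi_of_hasDerivAt_of_nonneg' hd hpos hl
  have : qt y ≤ ∫ x in Set.Ioi y, x * Real.exp (-x ^ 2 / 2) := by
    refine setIntegral_mono_on gd_int.integrableOn hI measurableSet_Ioi fun x hx => ?_
    have hx : y < x := hx
    unfold gd
    gcongr
    linarith [c_le]
  rw [hE] at this
  linarith

lemma qt_lower {y : ℝ} (hy : 1 ≤ y) :
    Real.exp (-1) * Real.exp (-(y + 1 / y) ^ 2 / 2) * (1 / y) ≤ qt y := by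
  have hy0 : 0 < 1 / y := by positivity
  have h1 := qt_split (show y ≤ y + 1 / y by linarith)
  have h2 := qt_pos (y + 1 / y)
  have h3 : ∫ t in Set.Ioc y (y + 1 / y), (Real.exp (-1) * Real.exp (-(y + 1 / y) ^ 2 / 2))
      ≤ ∫ t in Set.Ioc y (y + 1 / y), gd t := by
    refine setIntegral_mono_on (integrableOn_const (by simp)) gd_int.integrableOn measurableSet_Ioc fun x hx => ?_
    have hx0 : 0 ≤ x := by linarith [hx.1]
    have hx2 := hx.2
    unfold gd
    gcongr
    exact c_ge
  have h4 : ∫ t in Set.Ioc y (y + 1 / y), (Real.exp (-1) * Real.exp (-(y + 1 / y) ^ 2 / 2))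
      = Real.exp (-1) * Real.exp (-(y + 1 / y) ^ 2 / 2) * (1 / y) := by
    rw [setIntegral_const, measureReal_def, Real.volume_Ioc, ENNReal.toReal_ofReal (by linarith)]
    simp only [smul_eq_mul]; ring
  linarith

lemma T_lower {y : ℝ} (hy : 1 ≤ y) : y ^ 2 / 2 ≤ expTransform y := by
  have := Real.log_le_log (qt_pos y) (qt_upper hy)
  rw [Real.log_exp] at this
  rw [T_eq]; linarith

lemma T_upper {y : ℝ} (hy : 1 ≤ y) : expTransform y ≤ y ^ 2 / 2 + Real.log y + 5 / 2 := by
  have hy0 : 0 < y := by linarith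
  have := Real.log_le_log (by positivity) (qt_lower hy)
  rw [Real.log_mul (by positivity) (by positivity), Real.log_mul (by positivity) (by positivity),
    Real.log_exp, Real.log_exp, one_div, Real.log_inv] at this
  have h1 : y⁻¹ ≤ 1 := inv_le_one_of_one_le₀ hy
  have h0 : 0 < y⁻¹ := by positivity
  have h2 : (y + y⁻¹) ^ 2 = y ^ 2 + 2 + y⁻¹ ^ 2 := by field_simp; ring
  rw [T_eq]; nlinarith

/-- `T` is a strictly increasing bijection from `ℝ` onto `(0, ∞)`, and its inverse
satisfies `T⁻¹(x) = √(2x) + O(log x / √x)` as `x → ∞`. -/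
theorem expTransform_inverse_asymptotic
    (Tinv : ℝ → ℝ)
    (hleft : ∀ y : ℝ, Tinv (expTransform y) = y)
    (hright : ∀ x : ℝ, 0 < x → expTransform (Tinv x) = x) :
    StrictMono expTransform ∧ Set.range expTransform = Set.Ioi 0 ∧
    ∃ C > (0 : ℝ), ∃ x₀ > (1 : ℝ), ∀ x ≥ x₀,
      |Tinv x - Real.sqrt (2 * x)| ≤ C * Real.log x / Real.sqrt x := by
  refine ⟨T_mono, ?_, 7, by norm_num, max (expTransform 1) (Real.exp 1), ?_, ?_⟩
  · ext x
    constructor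
    · rintro ⟨y, rfl⟩
      have := Real.log_neg (qt_pos y) (qt_lt_one y)
      rw [T_eq, Set.mem_Ioi]; linarith
    · intro hx
      exact ⟨Tinv x, hright x hx⟩
  · exact lt_of_lt_of_le (by linarith [Real.exp_one_gt_d9]) (le_max_right _ _)
  · intro x hx
    have hx1 : expTransform 1 ≤ x := le_trans (le_max_left _ _) hx
    have hxe : Real.exp 1 ≤ x := le_trans (le_max_right _ _) hx
    have hx0 : 0 < x := lt_of_lt_of_le (Real.exp_pos 1) hxe
    have hlog : 1 ≤ Real.log x := (Real.le_log_iff_exp_le hx0).2 hxe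
    have hT := hright x hx0
    set y := Tinv x
    have hy : 1 ≤ y := by
      rw [← hT] at hx1
      exact T_mono.le_iff_le.1 hx1
    have hl := T_lower hy
    have hu := T_upper hy
    rw [hT] at hl hu
    have hs : 0 < Real.sqrt x := Real.sqrt_pos.2 hx0
    have hss := Real.sq_sqrt hx0.le
    have hr : 0 < Real.sqrt (2 * x) := by positivity
    have hrr := Real.sq_sqrt (show 0 ≤ 2 * x by positivity)
    have hsr : Real.sqrt x ≤ Real.sqrt (2 * x) := Real.sqrt_le_sqrt (by linarith)
    have hyr : y ≤ Real.sqrt (2 * x) := Real.le_sqrt_of_sq_le (by linarith)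
    have hly : Real.log y ≤ (Real.log 2 + Real.log x) / 2 := by
      have := Real.log_le_log (by linarith) hyr
      rw [Real.log_sqrt (by positivity), Real.log_mul (by norm_num) hx0.ne'] at this
      exact this
    rw [abs_of_nonpos (by linarith), le_div_iff₀ hs]
    have hl2 := Real.log_two_lt_d9
    nlinarith [mul_nonneg (sub_nonneg.2 hyr) (sub_nonneg.2 hsr),
      mul_nonneg (sub_nonneg.2 hyr) (show 0 ≤ y by linarith)]
end

section
/- Let Phi denote the cumulative distribution function of the standard normal distribution on R, define T(y) = -log(1 - Phi(y)), and let T^{-1} : (0, infinity) -> R be its inverse. Fix rho in (0, 1] and z in R. Then lim_{y -> infinity} [ T^{-1}( rho^2 * T(y) + (1 + rho * sqrt(T(y))) * z ) - rho * y ] = z / sqrt(2). (For z < 0 the argument of T^{-1} is positive for all sufficiently large y, so the expression is eventually well defined.) -/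
open MeasureTheory Filter Topology

noncomputable def auxQ (y : ℝ) : ℝ := ∫ t in Set.Ioi y, ProbabilityTheory.gaussianPDFReal 0 1 t

lemma aux_pdf (m t : ℝ) : ProbabilityTheory.gaussianPDFReal m 1 t =
    (Real.sqrt (2 * Real.pi))⁻¹ * Real.exp (-(t - m) ^ 2 / 2) := by
  simp [ProbabilityTheory.gaussianPDFReal]

lemma aux_one_sub (y : ℝ) : 1 - stdNormalCDF y = auxQ y := by
  have hi := ProbabilityTheory.integrable_gaussianPDFReal 0 1
  have h1 := ProbabilityTheory.integral_gaussianPDFReal_eq_one 0 (v := 1) one_ne_zero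
  have h2 := intervalIntegral.integral_Iic_add_Ioi (b := y) hi.integrableOn hi.integrableOn
  rw [h1] at h2
  have h3 : stdNormalCDF y = ∫ t in Set.Iic y, ProbabilityTheory.gaussianPDFReal 0 1 t := by
    unfold stdNormalCDF
    simp only [aux_pdf, sub_zero]
  rw [h3, auxQ]
  linarith

lemma auxQ_anti : Antitone auxQ := by
  intro a b hab
  have hi := ProbabilityTheory.integrable_gaussianPDFReal 0 1
  apply setIntegral_mono_set hi.integrableOn
  · exact Eventually.of_forall fun t => ProbabilityTheory.gaussianPDFReal_nonneg 0 1 t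
  · exact (Set.Ioi_subset_Ioi hab).eventuallyLE

lemma auxQ_lower (y d : ℝ) (hy : 0 ≤ y) (hd : 0 ≤ d) :
    d * ((Real.sqrt (2 * Real.pi))⁻¹ * Real.exp (-(y + d) ^ 2 / 2)) ≤ auxQ y := by
  have hi := ProbabilityTheory.integrable_gaussianPDFReal 0 1
  calc d * ((Real.sqrt (2 * Real.pi))⁻¹ * Real.exp (-(y + d) ^ 2 / 2))
      = ∫ t in Set.Ioc y (y + d), ((Real.sqrt (2 * Real.pi))⁻¹ * Real.exp (-(y + d) ^ 2 / 2)) := by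
        simp [hd]
    _ ≤ ∫ t in Set.Ioc y (y + d), ProbabilityTheory.gaussianPDFReal 0 1 t := by
        apply setIntegral_mono_on _ hi.integrableOn measurableSet_Ioc
        · intro t ht
          rw [aux_pdf]
          have : (t - 0) ^ 2 ≤ (y + d) ^ 2 := by
            apply pow_le_pow_left₀ <;> linarith [ht.1, ht.2]
          gcongr
        · exact integrableOn_const (by simp)
    _ ≤ auxQ y := by
        apply setIntegral_mono_set hi.integrableOn
        · exact Eventually.of_forall fun t => ProbabilityTheory.gaussianPDFReal_nonneg 0 1 t
        · exact Set.Ioc_subset_Ioi_self.eventuallyLE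

lemma auxQ_pos (y : ℝ) : 0 < auxQ y := by
  have h1 := auxQ_lower (max y 0) 1 (le_max_right _ _) zero_le_one
  have h2 := auxQ_anti (le_max_left y 0)
  have : 0 < 1 * ((Real.sqrt (2 * Real.pi))⁻¹ * Real.exp (-((max y 0) + 1) ^ 2 / 2)) := by
    positivity
  linarith

lemma auxQ_upper (y : ℝ) (hy : 0 ≤ y) : auxQ y ≤ Real.exp (-y ^ 2 / 2) := by
  have hi := ProbabilityTheory.integrable_gaussianPDFReal 0 1
  have hiy := ProbabilityTheory.integrable_gaussianPDFReal y 1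
  calc auxQ y ≤ ∫ t in Set.Ioi y, Real.exp (-y ^ 2 / 2) * ProbabilityTheory.gaussianPDFReal y 1 t := by
        apply setIntegral_mono_on hi.integrableOn (hiy.const_mul _).integrableOn measurableSet_Ioi
        intro t ht
        rw [aux_pdf, aux_pdf, mul_left_comm, ← Real.exp_add]
        have ht' : y < t := ht
        gcongr
        nlinarith
    _ ≤ ∫ t, Real.exp (-y ^ 2 / 2) * ProbabilityTheory.gaussianPDFReal y 1 t := by
        apply setIntegral_le_integral (hiy.const_mul _)
        exact Eventually.of_forall fun t =>
          mul_nonneg (Real.exp_pos _).le (ProbabilityTheory.gaussianPDFReal_nonneg y 1 t)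
    _ = _ := by
        rw [integral_const_mul, ProbabilityTheory.integral_gaussianPDFReal_eq_one y one_ne_zero,
          mul_one]

lemma auxT_mono : Monotone expTransform := by
  intro a b hab
  simp only [expTransform, aux_one_sub]
  exact neg_le_neg (Real.log_le_log (auxQ_pos b) (auxQ_anti hab))

lemma auxT_lower (y : ℝ) (hy : 0 ≤ y) : y ^ 2 / 2 ≤ expTransform y := by
  simp only [expTransform, aux_one_sub]
  have := Real.log_le_log (auxQ_pos y) (auxQ_upper y hy)
  rw [Real.log_exp] at this
  linarith

lemma auxT_upper (y : ℝ) (hy : 1 ≤ y) :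
    expTransform y ≤ y ^ 2 / 2 + Real.log y + (Real.log (Real.sqrt (2 * Real.pi)) + 2) := by
  simp only [expTransform, aux_one_sub]
  have hy0 : 0 < y := by linarith
  have hs : 0 < Real.sqrt (2 * Real.pi) := by positivity
  have h := Real.log_le_log (by positivity) (auxQ_lower y y⁻¹ (by linarith) (by positivity))
  rw [Real.log_mul (by positivity) (by positivity), Real.log_mul (by positivity) (by positivity),
    Real.log_exp, Real.log_inv, Real.log_inv] at h
  have h2 : (y + y⁻¹) ^ 2 = y ^ 2 + 2 + y⁻¹ ^ 2 := by field_simp; ring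
  have h3 : y⁻¹ ^ 2 ≤ 1 := by
    apply pow_le_one₀ (by positivity) (inv_le_one_of_one_le₀ hy)
  have h4 : -(y + y⁻¹) ^ 2 / 2 = -((y + y⁻¹) ^ 2) / 2 := by ring
  linarith

lemma aux_e : Tendsto (fun y => (expTransform y - y ^ 2 / 2) / y) atTop (𝓝 0) := by
  have h1 : Tendsto (fun y : ℝ => Real.log y / y + (Real.log (Real.sqrt (2 * Real.pi)) + 2) / y)
      atTop (𝓝 (0 + 0)) := by
    apply Tendsto.add
    · exact Real.isLittleO_log_id_atTop.tendsto_div_nhds_zero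
    · exact tendsto_const_nhds.div_atTop tendsto_id
  rw [add_zero] at h1
  apply tendsto_of_tendsto_of_tendsto_of_le_of_le' tendsto_const_nhds h1
  · filter_upwards [eventually_ge_atTop 1] with y hy
    have := auxT_lower y (by linarith)
    apply div_nonneg <;> linarith
  · filter_upwards [eventually_ge_atTop 1] with y hy
    have := auxT_upper y hy
    rw [← add_div]
    gcongr
    linarith

lemma aux_T2 : Tendsto (fun y => expTransform y / y ^ 2) atTop (𝓝 (1 / 2)) := by
  have h := (aux_e.mul tendsto_inv_atTop_zero).add_const (1 / 2 : ℝ)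
  rw [zero_mul, zero_add] at h
  apply h.congr'
  filter_upwards [eventually_gt_atTop 0] with y hy
  field_simp
  ring

lemma aux_sq : Tendsto (fun y => Real.sqrt (expTransform y) / y) atTop (𝓝 (1 / Real.sqrt 2)) := by
  have h := (Real.continuous_sqrt.tendsto _).comp aux_T2
  rw [Real.sqrt_div zero_le_one, Real.sqrt_one] at h
  apply h.congr'
  filter_upwards [eventually_gt_atTop 0] with y hy
  simp only [Function.comp]
  rw [Real.sqrt_div' _ (by positivity), Real.sqrt_sq hy.le]

/-- For `ρ ∈ (0,1]` and `z ∈ ℝ`,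
`T⁻¹(ρ² T(y) + (1 + ρ √(T(y))) z) - ρ y → z/√2` as `y → ∞`. -/
theorem expTransform_inverse_normalized_limit
    (Tinv : ℝ → ℝ)
    (hleft : ∀ y : ℝ, Tinv (expTransform y) = y)
    (hright : ∀ x : ℝ, 0 < x → expTransform (Tinv x) = x)
    (ρ : ℝ) (hρ : ρ ∈ Set.Ioc (0 : ℝ) 1) (z : ℝ) :
    Tendsto (fun y =>
        Tinv (ρ ^ 2 * expTransform y + (1 + ρ * Real.sqrt (expTransform y)) * z) - ρ * y)
      atTop (𝓝 (z / Real.sqrt 2)) := by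
  have hρ0 : 0 < ρ := hρ.1
  have hTinv : Tendsto Tinv atTop atTop := by
    rw [tendsto_atTop]
    intro M
    filter_upwards [eventually_gt_atTop 0, eventually_gt_atTop (expTransform M)] with x hx hxM
    by_contra hc
    have := auxT_mono (not_le.1 hc).le
    rw [hright x hx] at this
    linarith
  set A : ℝ → ℝ := fun y => ρ ^ 2 * expTransform y + (1 + ρ * Real.sqrt (expTransform y)) * z
    with hA
  have hinv : Tendsto (fun y : ℝ => y⁻¹) atTop (𝓝 0) := tendsto_inv_atTop_zero
  have hA2 : Tendsto (fun y => A y / y ^ 2) atTop (𝓝 (ρ ^ 2 / 2)) := by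
    have h := (aux_T2.const_mul (ρ ^ 2)).add
      (((hinv.mul hinv).mul_const z).add (((aux_sq.mul hinv).const_mul (ρ * z))))
    rw [show ρ ^ 2 * (1 / 2) + (0 * 0 * z + ρ * z * (1 / Real.sqrt 2 * 0)) = ρ ^ 2 / 2 by ring] at h
    apply h.congr'
    filter_upwards [eventually_gt_atTop 0] with y hy
    simp only [hA]
    field_simp
  have hAtop : Tendsto A atTop atTop := by
    have h := hA2.pos_mul_atTop (by positivity) (tendsto_pow_atTop (α := ℝ) two_ne_zero)
    apply h.congr'
    filter_upwards [eventually_gt_atTop 0] with y hy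
    field_simp
  set w : ℝ → ℝ := fun y => Tinv (A y) with hw
  have hwtop : Tendsto w atTop atTop := hTinv.comp hAtop
  have hTw : ∀ᶠ y in atTop, expTransform (w y) = A y := by
    filter_upwards [hAtop.eventually_gt_atTop 0] with y hy
    exact hright _ hy
  have hwpos := hwtop.eventually_gt_atTop 0
  have hwy2 : Tendsto (fun y => (A y / y ^ 2) / (expTransform (w y) / (w y) ^ 2)) atTop
      (𝓝 (ρ ^ 2)) := by
    have h := hA2.div (aux_T2.comp hwtop) (by norm_num)
    rw [show ρ ^ 2 / 2 / (1 / 2) = ρ ^ 2 by ring] at h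
    exact h
  have hwy : Tendsto (fun y => w y / y) atTop (𝓝 ρ) := by
    have h := (Real.continuous_sqrt.tendsto _).comp hwy2
    rw [Real.sqrt_sq hρ0.le] at h
    apply h.congr'
    filter_upwards [eventually_gt_atTop 0, hTw, hwpos, hAtop.eventually_gt_atTop 0]
      with y hy h1 h2 h3
    simp only [Function.comp]
    rw [h1]
    rw [show A y / y ^ 2 / (A y / w y ^ 2) = (w y / y) ^ 2 by field_simp]
    exact Real.sqrt_sq (by positivity)
  have hmain := ((((aux_e.const_mul (2 * ρ ^ 2)).add (hinv.const_mul (2 * z))).add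
    (aux_sq.const_mul (2 * ρ * z))).sub (((aux_e.comp hwtop).mul hwy).const_mul 2)).div
    (hwy.add_const ρ) (by positivity)
  have hval : (2 * ρ ^ 2 * 0 + 2 * z * 0 + 2 * ρ * z * (1 / Real.sqrt 2) - 2 * (0 * ρ)) / (ρ + ρ)
      = z / Real.sqrt 2 := by
    field_simp
    ring
  rw [hval] at hmain
  apply hmain.congr'
  filter_upwards [eventually_gt_atTop 0, hTw, hwpos] with y hy h1 h2
  change _ = w y - ρ * y
  simp only [Function.comp, Pi.div_apply]
  have h3 : 0 < w y / y + ρ := by positivity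
  rw [div_eq_iff h3.ne', h1]
  simp only [hA]
  field_simp
  ring
end

section
/- Let lambda be in (0, 1) and set c = -log(1 - lambda). Let f_V : R -> [0, infinity) be a measurable function satisfying f_V(v) <= C * exp(-v) for all v in R for some constant C > 0, and exp(v) * f_V(v) -> 1 as v -> infinity. Define f_X(x) = integral from 0 to infinity of exp(-q) * f_V(x - lambda*q + c) dq. Then lim_{x -> infinity} exp(x) * f_X(x) = 1. -/
open MeasureTheory Filter Topology

/-- If `f_V` is an exponential-tailed density (dominated by `C e^{-v}` with
`e^v f_V(v) → 1`), `λ ∈ (0,1)`, `c = -log(1-λ)` and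
`f_X(x) = ∫_0^∞ e^{-q} f_V(x - λq + c) dq`, then `e^x f_X(x) → 1` as `x → ∞`. -/
theorem density_convolution_exponential_tail
    (lam : ℝ) (hlam : lam ∈ Set.Ioo (0 : ℝ) 1)
    (fV : ℝ → ℝ) (hmeas : Measurable fV) (hnonneg : ∀ v, 0 ≤ fV v)
    (C : ℝ) (hC : 0 < C) (hbound : ∀ v, fV v ≤ C * Real.exp (-v))
    (htail : Tendsto (fun v => Real.exp v * fV v) atTop (𝓝 1)) :
    Tendsto (fun x => Real.exp x *
        ∫ q in Set.Ioi (0 : ℝ), Real.exp (-q) * fV (x - lam * q + (-Real.log (1 - lam))))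
      atTop (𝓝 1) := by
  obtain ⟨h0, h1⟩ := hlam
  have hpos : 0 < 1 - lam := by linarith
  have ha : lam - 1 < 0 := by linarith
  have key : ∀ x q : ℝ, Real.exp x * (Real.exp (-q) * fV (x - lam * q + (-Real.log (1 - lam))))
      = ((1 - lam) * Real.exp ((lam - 1) * q)) *
        (Real.exp (x - lam * q + (-Real.log (1 - lam))) *
          fV (x - lam * q + (-Real.log (1 - lam)))) := by
    intro x q
    have h : Real.exp x * Real.exp (-q) = (1 - lam) * Real.exp ((lam - 1) * q) *
        Real.exp (x - lam * q + (-Real.log (1 - lam))) := by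
      conv_rhs => rw [← Real.exp_log hpos]
      rw [← Real.exp_add, ← Real.exp_add, ← Real.exp_add]
      congr 1
      rw [Real.exp_log hpos]
      ring
    rw [← mul_assoc, h, mul_assoc]
  have hint : ∫ q in Set.Ioi (0 : ℝ), (1 - lam) * Real.exp ((lam - 1) * q) = 1 := by
    rw [integral_const_mul, integral_exp_mul_Ioi ha]
    have : lam - 1 ≠ 0 := ha.ne
    simp only [mul_zero, Real.exp_zero]
    field_simp
    ring
  simp_rw [← integral_const_mul, key]
  refine Eq.subst (motive := fun t => Tendsto _ atTop (𝓝 t)) hint ?_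
  refine tendsto_integral_filter_of_dominated_convergence
    (fun q => ((1 - lam) * Real.exp ((lam - 1) * q)) * C) ?_ ?_ ?_ ?_
  · refine Eventually.of_forall fun x => Measurable.aestronglyMeasurable ?_
    fun_prop
  · refine Eventually.of_forall fun x => Eventually.of_forall fun q => ?_
    have hb : ∀ v, Real.exp v * fV v ≤ C := by
      intro v
      calc Real.exp v * fV v ≤ Real.exp v * (C * Real.exp (-v)) :=
            mul_le_mul_of_nonneg_left (hbound v) (Real.exp_pos v).le
        _ = C * (Real.exp v * Real.exp (-v)) := by ring
        _ = C := by rw [← Real.exp_add]; simp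
    have hn : ∀ v, 0 ≤ Real.exp v * fV v := fun v => mul_nonneg (Real.exp_pos v).le (hnonneg v)
    have hp : 0 ≤ (1 - lam) * Real.exp ((lam - 1) * q) :=
      mul_nonneg hpos.le (Real.exp_pos _).le
    rw [Real.norm_of_nonneg (mul_nonneg hp (hn _))]
    exact mul_le_mul_of_nonneg_left (hb _) hp
  · exact ((integrableOn_exp_mul_Ioi ha 0).const_mul _).mul_const _
  · refine Eventually.of_forall fun q => ?_
    have ht : Tendsto (fun x : ℝ => x - lam * q + (-Real.log (1 - lam))) atTop atTop :=
      tendsto_atTop_add_const_right _ _ (tendsto_atTop_add_const_right _ (-(lam * q)) tendsto_id)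
    simpa using (htail.comp ht).const_mul ((1 - lam) * Real.exp ((lam - 1) * q))
end

section
/- Let lambda be in (0, 1) and set c = -log(1 - lambda). Let f_V : R -> [0, infinity) be a measurable function satisfying f_V(v) <= C * exp(-v) for all v in R for some constant C > 0, and exp(v) * f_V(v) -> 1 as v -> infinity. Define f_X(x) = integral from 0 to infinity of exp(-q') * f_V(x - lambda*q' + c) dq'. Then for every q > 0, lim_{x -> infinity} [ exp(-q) * f_V(x - lambda*q + c) ] / f_X(x) = (1 - lambda) * exp( -(1 - lambda) * q ). -/
open MeasureTheory Filter Topology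

/-- Under the same hypotheses as the exponential-tail lemma, the conditional density of `Q`
given `X = x`, namely `e^{-q} f_V(x - λq + c)/f_X(x)`, converges as `x → ∞` to the density
of an exponential distribution with rate `1 - λ`. -/
theorem conditional_density_limit_exponential
    (lam : ℝ) (hlam : lam ∈ Set.Ioo (0 : ℝ) 1)
    (fV : ℝ → ℝ) (hmeas : Measurable fV) (hnonneg : ∀ v, 0 ≤ fV v)
    (C : ℝ) (hC : 0 < C) (hbound : ∀ v, fV v ≤ C * Real.exp (-v))
    (htail : Tendsto (fun v => Real.exp v * fV v) atTop (𝓝 1)) :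
    ∀ q : ℝ, 0 < q →
      Tendsto (fun x =>
          Real.exp (-q) * fV (x - lam * q + (-Real.log (1 - lam))) /
            ∫ q' in Set.Ioi (0 : ℝ),
              Real.exp (-q') * fV (x - lam * q' + (-Real.log (1 - lam))))
        atTop (𝓝 ((1 - lam) * Real.exp (-(1 - lam) * q))) := by
  obtain ⟨h0, h1⟩ := hlam
  generalize -Real.log (1 - lam) = k
  have key : ∀ x q : ℝ, Real.exp (x + k) * (Real.exp (-q) * fV (x - lam * q + k)) =
      Real.exp (-(1 - lam) * q) * (Real.exp (x - lam * q + k) * fV (x - lam * q + k)) := by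
    intro x q
    rw [← mul_assoc, ← mul_assoc, ← Real.exp_add, ← Real.exp_add]
    congr 2
    ring
  have lim : ∀ q : ℝ, Tendsto
      (fun x => Real.exp (x + k) * (Real.exp (-q) * fV (x - lam * q + k))) atTop
      (𝓝 (Real.exp (-(1 - lam) * q))) := by
    intro q
    simp only [key]
    have h : Tendsto (fun x : ℝ => x - lam * q + k) atTop atTop :=
      tendsto_atTop_add_const_right _ _ (tendsto_atTop_add_const_right _ (-(lam * q)) tendsto_id)
    simpa using (htail.comp h).const_mul (Real.exp (-(1 - lam) * q))
  have hneg : -(1 - lam) < 0 := by linarith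
  have bd : ∀ v, Real.exp v * fV v ≤ C := by
    intro v
    calc Real.exp v * fV v ≤ Real.exp v * (C * Real.exp (-v)) :=
          mul_le_mul_of_nonneg_left (hbound v) (Real.exp_pos v).le
      _ = C := by rw [Real.exp_neg]; field_simp
  have limI : Tendsto (fun x => ∫ q in Set.Ioi (0 : ℝ),
      Real.exp (x + k) * (Real.exp (-q) * fV (x - lam * q + k))) atTop
      (𝓝 (∫ q in Set.Ioi (0 : ℝ), Real.exp (-(1 - lam) * q))) := by
    refine tendsto_integral_filter_of_dominated_convergence
      (fun q => Real.exp (-(1 - lam) * q) * C) ?_ ?_ ?_ ?_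
    · refine Eventually.of_forall fun x => Measurable.aestronglyMeasurable ?_
      fun_prop
    · refine Eventually.of_forall fun x => Eventually.of_forall fun q => ?_
      rw [key, Real.norm_of_nonneg (mul_nonneg (Real.exp_pos _).le
        (mul_nonneg (Real.exp_pos _).le (hnonneg _)))]
      exact mul_le_mul_of_nonneg_left (bd _) (Real.exp_pos _).le
    · exact (integrableOn_exp_mul_Ioi hneg 0).mul_const C
    · exact Eventually.of_forall fun q => lim q
  rw [integral_exp_mul_Ioi hneg 0] at limI
  intro q _
  have hne : (1 - lam) ≠ 0 := by linarith
  have := (lim q).div limI (by simp [hne, div_eq_zero_iff, neg_eq_zero, sub_eq_zero]; grind)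
  convert this using 2 with x
  · rw [Pi.div_apply, integral_const_mul, mul_div_mul_left _ _ (Real.exp_pos _).ne']
  · simp only [mul_zero, Real.exp_zero]
    rw [neg_div_neg_eq]
    field_simp
end

section
/- Let E be an exponentially distributed random variable with rate 1, let Z be a real random variable independent of E, let zeta >= 0 and beta < 0, and define b(v) = (1 + zeta * v^beta)^{-1} for v > 0. Then: (a) for every x > 0, P( E + b(x + E) * Z > 0 ) = integral from 0 to infinity of P( Z > -r / b(r + x) ) * exp(-r) dr; (b) the function x -> P( E + b(x + E) * Z > 0 ) is nonincreasing on (0, infinity); and (c) lim_{x -> infinity} P( E + b(x + E) * Z > 0 ) = P( E + Z > 0 ). -/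
open MeasureTheory ProbabilityTheory Filter Topology

lemma aux_map {Ω : Type*} [MeasurableSpace Ω] (μ : Measure Ω) [IsProbabilityMeasure μ]
    (E : Ω → ℝ) (hEm : Measurable E)
    (hE : ∀ t : ℝ, 0 ≤ t → (μ {ω | t < E ω}).toReal = Real.exp (-t)) :
    μ.map E = expMeasure 1 := by
  have : IsProbabilityMeasure (μ.map E) := Measure.isProbabilityMeasure_map hEm.aemeasurable
  have : IsProbabilityMeasure (expMeasure 1) := isProbabilityMeasure_expMeasure one_pos
  apply Measure.eq_of_cdf
  ext x
  have key : ∀ t : ℝ, 0 ≤ t → (μ {ω | E ω ≤ t}).toReal = 1 - Real.exp (-t) := by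
    intro t ht
    have h1 : {ω | E ω ≤ t} = {ω | t < E ω}ᶜ := by ext; simp
    have hm : MeasurableSet {ω | t < E ω} := measurableSet_lt measurable_const hEm
    rw [h1]
    have := probReal_compl_eq_one_sub (μ := μ) hm
    rw [measureReal_def, measureReal_def, hE t ht] at this
    exact this
  rw [cdf_expMeasure_eq one_pos, cdf_eq_real, measureReal_def, Measure.map_apply hEm measurableSet_Iic]
  change (μ {ω | E ω ≤ x}).toReal = _
  split_ifs with h
  · rw [key x h, one_mul]
  · have h0 := key 0 le_rfl
    push Not at h
    have h2 : (μ {ω | E ω ≤ x}).toReal ≤ (μ {ω | E ω ≤ 0}).toReal :=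
      ENNReal.toReal_mono (measure_ne_top _ _) (measure_mono fun ω hω => le_trans hω h.le)
    have h3 : 0 ≤ (μ {ω | E ω ≤ x}).toReal := ENNReal.toReal_nonneg
    rw [neg_zero, Real.exp_zero, sub_self] at h0
    linarith

lemma aux_iff {c e z : ℝ} (hc : 0 < c) : 0 < e + c⁻¹ * z ↔ 0 < c * e + z := by
  have : c * e + z = c * (e + c⁻¹ * z) := by field_simp
  rw [this, mul_pos_iff_of_pos_left hc]

/-- Model 1 subasymptotic dependence: with `b(v) = (1 + ζ v^β)⁻¹`, `ζ ≥ 0`, `β < 0`,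
`E ~ Exp(1)` independent of `Z`:
(a) `P(E + b(x+E)Z > 0) = ∫_0^∞ P(Z > -r/b(r+x)) e^{-r} dr` for `x > 0`;
(b) `x ↦ P(E + b(x+E)Z > 0)` is nonincreasing on `(0,∞)`;
(c) it converges to `P(E + Z > 0)` as `x → ∞`. -/
theorem model1_chi_monotone_limit
    {Ω : Type*} [MeasurableSpace Ω] (μ : Measure Ω) [IsProbabilityMeasure μ]
    (E Z : Ω → ℝ) (hEm : Measurable E) (hZm : Measurable Z)
    (hindep : IndepFun E Z μ)
    (hE : ∀ t : ℝ, 0 ≤ t → (μ {ω | t < E ω}).toReal = Real.exp (-t))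
    (ζ β : ℝ) (hζ : 0 ≤ ζ) (hβ : β < 0) :
    (∀ x : ℝ, 0 < x →
      (μ {ω | 0 < E ω + (1 + ζ * (x + E ω) ^ β)⁻¹ * Z ω}).toReal
        = ∫ r in Set.Ioi (0 : ℝ),
            (μ {ω | -r / (1 + ζ * (r + x) ^ β)⁻¹ < Z ω}).toReal * Real.exp (-r)) ∧
    AntitoneOn (fun x : ℝ =>
        (μ {ω | 0 < E ω + (1 + ζ * (x + E ω) ^ β)⁻¹ * Z ω}).toReal) (Set.Ioi 0) ∧
    Tendsto (fun x : ℝ =>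
        (μ {ω | 0 < E ω + (1 + ζ * (x + E ω) ^ β)⁻¹ * Z ω}).toReal)
      atTop (𝓝 ((μ {ω | 0 < E ω + Z ω}).toReal)) := by
  have hmap := aux_map μ E hEm hE
  have hprob : IsProbabilityMeasure (expMeasure 1) := isProbabilityMeasure_expMeasure one_pos
  have hprobZ : IsProbabilityMeasure (μ.map Z) := Measure.isProbabilityMeasure_map hZm.aemeasurable
  have hprod : μ.map (fun ω => (E ω, Z ω)) = (expMeasure 1).prod (μ.map Z) := by
    rw [← hmap]
    exact (indepFun_iff_map_prod_eq_prod_map_map hEm.aemeasurable hZm.aemeasurable).1 hindep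
  have hpair : Measurable (fun ω => (E ω, Z ω)) := hEm.prodMk hZm
  have hcpos : ∀ v : ℝ, 0 < v → 0 < 1 + ζ * v ^ β := fun v hv => by
    have := Real.rpow_nonneg hv.le β
    positivity
  have hEpos : ∀ᵐ ω ∂μ, 0 < E ω := by
    have h1 : μ {ω | 0 < E ω} = 1 := by
      have := hE 0 le_rfl
      simp only [neg_zero, Real.exp_zero] at this
      rwa [ENNReal.toReal_eq_one_iff] at this
    exact (prob_compl_eq_zero_iff (measurableSet_lt measurable_const hEm)).2 h1
  have hna : ∀ a : ℝ, expMeasure 1 {a} = 0 := by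
    intro a
    exact withDensity_absolutelyContinuous _ _ (by simp)
  have hne : ∀ᵐ ω ∂μ, E ω + Z ω ≠ 0 := by
    have hS : MeasurableSet {p : ℝ × ℝ | p.1 + p.2 = 0} :=
      measurableSet_eq_fun (by fun_prop) (by fun_prop)
    have h0 : μ {ω | E ω + Z ω = 0} = 0 := by
      have : μ {ω | E ω + Z ω = 0} = μ.map (fun ω => (E ω, Z ω)) {p : ℝ × ℝ | p.1 + p.2 = 0} := by
        rw [Measure.map_apply hpair hS]; rfl
      rw [this, hprod, Measure.prod_apply_symm hS]
      have : ∀ y : ℝ, (fun x => (x, y)) ⁻¹' {p : ℝ × ℝ | p.1 + p.2 = 0} = {-y} := by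
        intro y; ext x; simp [add_eq_zero_iff_eq_neg]
      simp [this, hna]
    rw [ae_iff]
    simpa using h0
  refine ⟨?_, ?_, ?_⟩
  · intro x hx
    have hS : MeasurableSet {p : ℝ × ℝ | 0 < p.1 + (1 + ζ * (x + p.1) ^ β)⁻¹ * p.2} :=
      measurableSet_lt (by fun_prop) (by fun_prop)
    have : μ {ω | 0 < E ω + (1 + ζ * (x + E ω) ^ β)⁻¹ * Z ω}
        = μ.map (fun ω => (E ω, Z ω)) {p : ℝ × ℝ | 0 < p.1 + (1 + ζ * (x + p.1) ^ β)⁻¹ * p.2} := by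
      rw [Measure.map_apply hpair hS]; rfl
    rw [this, hprod, Measure.prod_apply hS, ← integral_toReal
      (measurable_measure_prodMk_left hS).aemeasurable
      (ae_of_all _ fun _ => measure_lt_top _ _)]
    have hexp : expMeasure 1 = volume.withDensity (exponentialPDF 1) := rfl
    have hpm : Measurable (exponentialPDF 1) :=
      (measurable_exponentialPDFReal 1).ennreal_ofReal
    rw [hexp, integral_withDensity_eq_integral_toReal_smul hpm
      (ae_of_all _ fun _ => ENNReal.ofReal_lt_top), ← integral_Ici_eq_integral_Ioi,
      ← integral_indicator measurableSet_Ici]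
    congr 1
    ext r
    by_cases hr : 0 ≤ r
    · rw [Set.indicator_of_mem (show r ∈ Set.Ici (0:ℝ) from hr), exponentialPDF_of_nonneg hr,
        ENNReal.toReal_ofReal (by positivity), smul_eq_mul, one_mul, one_mul, mul_comm,
        Measure.map_apply hZm (measurable_prodMk_left hS)]
      congr 3
      ext ω
      have hc := hcpos (x + r) (by linarith)
      simp only [Set.mem_preimage, Set.mem_ofPred_eq]
      rw [aux_iff hc, add_comm r x, div_inv_eq_mul]
      constructor <;> intro h <;> linarith
    · rw [Set.indicator_of_notMem (by simpa using hr), exponentialPDF_of_neg (not_le.1 hr)]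
      simp
  · intro x hx y hy hxy
    refine ENNReal.toReal_mono (measure_ne_top _ _) (measure_mono_ae ?_)
    filter_upwards [hEpos] with ω hω h
    change 0 < _ at h
    change 0 < _
    have hx : 0 < x := hx
    rw [aux_iff (hcpos _ (by linarith))] at h ⊢
    have h1 : (y + E ω) ^ β ≤ (x + E ω) ^ β :=
      Real.rpow_le_rpow_of_nonpos (by linarith) (by linarith) hβ.le
    have h2 := mul_le_mul_of_nonneg_right (mul_le_mul_of_nonneg_left h1 hζ) hω.le
    linarith
  · refine (ENNReal.tendsto_toReal (measure_ne_top _ _)).comp ?_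
    refine tendsto_measure_of_ae_tendsto_indicator_of_isFiniteMeasure atTop
      (measurableSet_lt (by fun_prop) (by fun_prop))
      (fun x => measurableSet_lt (by fun_prop) (by fun_prop)) ?_
    filter_upwards [hEpos, hne] with ω hω hn
    have hpow : Tendsto (fun x : ℝ => (x + E ω) ^ β) atTop (𝓝 0) := by
      have := tendsto_rpow_neg_atTop (neg_pos.2 hβ)
      rw [neg_neg] at this
      exact this.comp (tendsto_atTop_add_const_right _ _ tendsto_id)
    have hlim : Tendsto (fun x : ℝ => (1 + ζ * (x + E ω) ^ β) * E ω + Z ω) atTop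
        (𝓝 (E ω + Z ω)) := by
      have := (((hpow.const_mul ζ).const_add 1).mul_const (E ω)).add_const (Z ω)
      simpa using this
    rcases lt_or_gt_of_ne hn with h | h
    · filter_upwards [hlim.eventually_lt_const h, eventually_gt_atTop 0] with x h1 h2
      change (0 < E ω + (1 + ζ * (x + E ω) ^ β)⁻¹ * Z ω) ↔ 0 < E ω + Z ω
      rw [aux_iff (hcpos _ (by linarith))]
      constructor <;> intro <;> linarith
    · filter_upwards [hlim.eventually_const_lt h, eventually_gt_atTop 0] with x h1 h2
      change (0 < E ω + (1 + ζ * (x + E ω) ^ β)⁻¹ * Z ω) ↔ 0 < E ω + Z ω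
      rw [aux_iff (hcpos _ (by linarith))]
      constructor <;> intro <;> linarith
end

section
/- Let Z be a real random variable, let alpha be in (0, 1), and let beta be in [0, 1). Then lim_{x -> infinity} integral from 0 to infinity of P( Z > (x - alpha*(r + x)) / (r + x)^beta ) * exp(-r) dr = 0. -/
open MeasureTheory Filter Topology

/-- Model 2 asymptotic independence: for a random variable `Z`, `α ∈ (0,1)`, `β ∈ [0,1)`,
`∫_0^∞ P(Z > (x - α(r+x))/(r+x)^β) e^{-r} dr → 0` as `x → ∞`. -/
theorem model2_chi_tends_to_zero
    {Ω : Type*} [MeasurableSpace Ω] (μ : Measure Ω) [IsProbabilityMeasure μ]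
    (Z : Ω → ℝ) (hZ : Measurable Z)
    (α : ℝ) (hα : α ∈ Set.Ioo (0 : ℝ) 1) (β : ℝ) (hβ : β ∈ Set.Ico (0 : ℝ) 1) :
    Tendsto (fun x : ℝ => ∫ r in Set.Ioi (0 : ℝ),
        (μ {ω | (x - α * (r + x)) / (r + x) ^ β < Z ω}).toReal * Real.exp (-r))
      atTop (𝓝 0) := by
  obtain ⟨hα0, hα1⟩ := hα
  obtain ⟨hβ0, hβ1⟩ := hβ
  have hanti : Antitone (fun t : ℝ => {ω | t < Z ω}) := fun s t hst ω h => lt_of_le_of_lt hst h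
  have hGm : Measurable (fun t : ℝ => (μ {ω | t < Z ω})) :=
    Antitone.measurable (fun s t hst => measure_mono (hanti hst))
  have hG : Tendsto (fun t : ℝ => (μ {ω | t < Z ω}).toReal) atTop (𝓝 0) := by
    have h := tendsto_measure_iInter_atTop (μ := μ) (s := fun t : ℝ => {ω | t < Z ω})
      (fun t => (measurableSet_lt measurable_const hZ).nullMeasurableSet) hanti
      ⟨0, measure_ne_top _ _⟩
    have he : (⋂ t : ℝ, {ω | t < Z ω}) = ∅ := by
      ext ω
      simp only [Set.mem_iInter, Set.mem_ofPred_eq, Set.mem_empty_iff_false, iff_false, not_forall]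
      exact ⟨Z ω, lt_irrefl _⟩
    rw [he, measure_empty] at h
    exact (ENNReal.tendsto_toReal ENNReal.zero_ne_top).comp h
  have h0 : ∫ r in Set.Ioi (0 : ℝ), (0 : ℝ) = 0 := by simp
  refine le_trans ?_ (le_of_eq (congrArg 𝓝 h0))
  refine tendsto_integral_filter_of_dominated_convergence (fun r => Real.exp (-r)) ?_ ?_ ?_ ?_
  · refine Eventually.of_forall fun x => Measurable.aestronglyMeasurable ?_
    have : Measurable (fun r : ℝ => (x - α * (r + x)) / (r + x) ^ β) := by fun_prop
    exact ((hGm.comp this).ennreal_toReal).mul (by fun_prop)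
  · refine Eventually.of_forall fun x => Eventually.of_forall fun r => ?_
    rw [Real.norm_of_nonneg (by positivity)]
    have : (μ {ω | (x - α * (r + x)) / (r + x) ^ β < Z ω}).toReal ≤ 1 :=
      ENNReal.toReal_le_of_le_ofReal zero_le_one (by simpa using prob_le_one)
    exact mul_le_of_le_one_left (Real.exp_pos _).le this
  · exact integrableOn_exp_neg_Ioi 0
  · filter_upwards [ae_restrict_mem measurableSet_Ioi] with r hr
    have hr : 0 < r := hr
    have ht : Tendsto (fun x : ℝ => (x - α * (r + x)) / (r + x) ^ β) atTop atTop := by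
      have hy : Tendsto (fun x : ℝ => r + x) atTop atTop := tendsto_atTop_add_const_left _ _ tendsto_id
      have h1 : Tendsto (fun x : ℝ => (1 - α) * (r + x) ^ (1 - β) + (-r)) atTop atTop :=
        tendsto_atTop_add_const_right _ _
          (((tendsto_rpow_atTop (by linarith : 0 < 1 - β)).comp hy).const_mul_atTop (by linarith))
      refine tendsto_atTop_mono' _ ?_ h1
      filter_upwards [eventually_ge_atTop 1] with x hx
      have hp : 0 < r + x := by linarith
      have hb : 1 ≤ (r + x) ^ β := Real.one_le_rpow (by linarith) hβ0
      rw [le_div_iff₀ (by linarith), add_mul, mul_assoc, ← Real.rpow_add hp]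
      simp only [sub_add_cancel, Real.rpow_one]
      nlinarith
    simpa using (hG.comp ht).mul_const (Real.exp (-r))
end
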